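/- For any r ≥ 3 and s, t ≥ 2, and sufficiently large n, every K_{s,t}^{(r)}-free r-uniform hypergraph on n vertices has at most n^{r − 1/(s−1)}·(log n)^{2r} edges. -/

import Mathlib

open Finset
open scoped Classical

noncomputable section

variable {V : Type}

/-- Number of edges of the hypergraph `G` containing the vertex set `A`. -/
def degSet (G : Finset (Finset V)) (A : Finset V) : ℕ :=
  (G.filter fun e => A ⊆ e).card

/-- The neighborhood of an `(r-1)`-tuple `T`: vertices completing `T` to an edge. -/
def linkN [Fintype V] (G : Finset (Finset V)) (T : Finset V) : Finset V :=
  Finset.univ.filter fun v => v ∉ T ∧ insert v T ∈ G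

/-- Common link `CN_G(S)`: the `(r-1)`-sets forming an edge with every vertex of `S`. -/
def CN (r : ℕ) [Fintype V] (G : Finset (Finset V)) (S : Finset V) : Finset (Finset V) :=
  Finset.univ.filter fun T : Finset V =>
    T.card = r - 1 ∧ ∀ v ∈ S, v ∉ T ∧ insert v T ∈ G

/-- `cd_G(S|u)`: number of members of `CN_G(S)` containing `u`. -/
def cdOn (r : ℕ) [Fintype V] (G : Finset (Finset V)) (S : Finset V) (u : V) : ℕ :=
  ((CN r G S).filter fun T => u ∈ T).card

/-- `C` is a vertex cover of the set family `E`. -/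
def IsVertexCover (C : Finset V) (E : Finset (Finset V)) : Prop :=
  ∀ T ∈ E, ∃ v ∈ C, v ∈ T

/-- `G` contains no copy of `K_{s,t}^{(r)}`. -/
def KstFree (r s t : ℕ) (G : Finset (Finset V)) : Prop :=
  ¬ ∃ (X : Fin t → Finset V) (Y : Finset V),
      (∀ i, (X i).card = r - 1) ∧ Y.card = s ∧
      (∀ i j, i ≠ j → Disjoint (X i) (X j)) ∧
      (∀ i, Disjoint (X i) Y) ∧
      ∀ i, ∀ y ∈ Y, insert y (X i) ∈ G

/-- `G` is a balanced `r`-partite `r`-uniform hypergraph with parts `parts` of size `n`. -/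
def IsPartite (r n : ℕ) (parts : Fin r → Finset V) (G : Finset (Finset V)) : Prop :=
  (∀ i j, i ≠ j → Disjoint (parts i) (parts j)) ∧
  (∀ v : V, ∃ i, v ∈ parts i) ∧
  (∀ i, (parts i).card = n) ∧
  ∀ e ∈ G, ∀ i, (e ∩ parts i).card = 1

/-- `(ε, α)`-regularity in the sense of the paper. -/
def RegularHG (r s n : ℕ) (parts : Fin r → Finset V) (G : Finset (Finset V)) (ε α : ℝ) : Prop :=
  (n : ℝ) ^ ((r : ℝ) - 1 / ((s : ℝ) - 1) - ε) ≤ (G.card : ℝ) ∧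
  ∀ i : Fin r, ∃ Δ : ℝ,
    (n : ℝ) ^ (1 - 1 / ((s : ℝ) - 1) - ε) ≤ Δ ∧
    Δ ≤ (n : ℝ) ^ (1 - 1 / ((s : ℝ) - 1) + ε) ∧
    ∀ T : Finset V, T.card = r - 1 → Disjoint T (parts i) → 1 ≤ degSet G T →
      Δ / α ≤ (degSet G T : ℝ) ∧ (degSet G T : ℝ) ≤ Δ

/-- The pair `(T; v)` is `δ`-dense on `u` in `G`. -/
def DenseOn (r s n : ℕ) [Fintype V] (G : Finset (Finset V)) (T : Finset V) (v u : V)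
    (δ : ℝ) : Prop :=
  (degSet G T : ℝ) ^ (s - 1) / (r : ℝ) ≤
    ((((linkN G T).powersetCard s).filter fun S =>
      v ∈ S ∧ (n : ℝ) ^ ((r : ℝ) - 2 - 1 / ((s : ℝ) - 1) - δ) ≤ (cdOn r G S u : ℝ)).card : ℝ)

/-- The relation `V_i →_δ^{H,G} V_j`. -/
def Arrow (r s n : ℕ) [Fintype V] (parts : Fin r → Finset V) (H G : Finset (Finset V))
    (i j : Fin r) (δ : ℝ) : Prop :=
  ∀ T : Finset V, T.card = r - 1 → Disjoint T (parts j) → 1 ≤ degSet H T →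
    ∀ v ∈ linkN H T, ∀ u ∈ T ∩ parts i, DenseOn r s n G T v u δ

theorem exists_disjoint_or_cover (F : Finset (Finset V)) (m : ℕ)
    (hF : ∀ T ∈ F, T.card = m) (t : ℕ) :
    (∃ X : Fin t → Finset V, (∀ i, X i ∈ F) ∧ ∀ i j, i ≠ j → Disjoint (X i) (X j)) ∨
      ∃ C : Finset V, C.card ≤ t * m ∧ IsVertexCover C F := by
  induction t with
  | zero => exact Or.inl ⟨Fin.elim0, fun i => i.elim0, fun i => i.elim0⟩
  | succ t ih =>
    rcases ih with ⟨X, hX, hd⟩ | ⟨C, hC, hcov⟩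
    · by_cases h : IsVertexCover (Finset.univ.biUnion X) F
      · refine Or.inr ⟨_, ?_, h⟩
        have := Finset.card_biUnion_le_card_mul (Finset.univ : Finset (Fin t)) X m
          fun i _ => (hF _ (hX i)).le
        rw [Finset.card_univ, Fintype.card_fin] at this
        exact this.trans (Nat.mul_le_mul_right _ (Nat.le_succ t))
      · unfold IsVertexCover at h
        push Not at h
        obtain ⟨T, hT, hTC⟩ := h
        have hdT : ∀ i, Disjoint T (X i) := fun i => Finset.disjoint_right.mpr fun v hv =>
          hTC v (Finset.mem_biUnion.mpr ⟨i, Finset.mem_univ i, hv⟩)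
        refine Or.inl ⟨Fin.cons T X, ?_, ?_⟩
        · intro i
          refine Fin.cases ?_ ?_ i
          · simpa using hT
          · simpa using hX
        · intro i j
          refine Fin.cases ?_ (fun i => ?_) i <;> refine Fin.cases ?_ (fun j => ?_) j
          · simp
          · intro _
            simpa using hdT j
          · intro _
            simpa using (hdT i).symm
          · intro hij
            simpa using hd i j fun h => hij (by rw [h])
    · exact Or.inr ⟨C, hC.trans (Nat.mul_le_mul_right _ (Nat.le_succ t)), hcov⟩

theorem degSet_le_card_linkN [Fintype V] {r : ℕ} (hr : 1 ≤ r) {G : Finset (Finset V)}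
    (hG : ∀ e ∈ G, e.card = r) {W : Finset V} (hW : W.card = r - 1) :
    degSet G W ≤ (linkN G W).card := by
  have hsub : (G.filter fun e => W ⊆ e) ⊆ (linkN G W).image fun v => insert v W := by
    intro e he
    obtain ⟨he, hWe⟩ := Finset.mem_filter.mp he
    have h1 : (e \ W).card = 1 := by
      rw [Finset.card_sdiff_of_subset hWe, hG e he, hW]
      omega
    obtain ⟨v, hv⟩ := Finset.card_eq_one.mp h1
    have hvm : v ∈ e \ W := by simp [hv]
    have hins : insert v W = e := by
      rw [Finset.insert_eq, ← hv, Finset.sdiff_union_of_subset hWe]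
    refine Finset.mem_image.mpr ⟨v, ?_, hins⟩
    simp only [linkN, Finset.mem_filter, Finset.mem_univ, true_and]
    exact ⟨(Finset.mem_sdiff.mp hvm).2, hins ▸ he⟩
  exact (Finset.card_le_card hsub).trans Finset.card_image_le

theorem card_supersets_le [Fintype V] (P : Finset V) (m : ℕ) :
    ((Finset.univ : Finset (Finset V)).filter fun W => W.card = m ∧ P ⊆ W).card ≤
      Fintype.card V ^ (m - P.card) := by
  have h : ((Finset.univ : Finset (Finset V)).filter fun W => W.card = m ∧ P ⊆ W).card ≤
      ((Finset.univ : Finset V).powersetCard (m - P.card)).card := by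
    refine Finset.card_le_card_of_injOn (fun W => W \ P) ?_ ?_
    · intro W hW
      obtain ⟨-, hWm, hPW⟩ := Finset.mem_filter.mp (Finset.mem_coe.mp hW)
      rw [Finset.mem_coe, Finset.mem_powersetCard]
      exact ⟨Finset.subset_univ _, by rw [Finset.card_sdiff_of_subset hPW, hWm]⟩
    · intro W hW W' hW' h
      obtain ⟨-, -, hPW⟩ := Finset.mem_filter.mp (Finset.mem_coe.mp hW)
      obtain ⟨-, -, hPW'⟩ := Finset.mem_filter.mp (Finset.mem_coe.mp hW')
      rw [← Finset.sdiff_union_of_subset hPW, ← Finset.sdiff_union_of_subset hPW']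
      exact congrArg (· ∪ P) h
  refine h.trans ?_
  rw [Finset.card_powersetCard, Finset.card_univ]
  exact Nat.choose_le_pow _ _

theorem degSet_pair_le [Fintype V] {r Δ : ℕ} (hr : 3 ≤ r) {G : Finset (Finset V)}
    (hG : ∀ e ∈ G, e.card = r)
    (hΔ : ∀ T : Finset V, T.card = r - 1 → (linkN G T).card ≤ Δ) {u v : V} (huv : u ≠ v) :
    degSet G {u, v} ≤ Fintype.card V ^ (r - 3) * Δ := by
  have hP : ({u, v} : Finset V).card = 2 := Finset.card_pair huv
  have hsub : (G.filter fun e => {u, v} ⊆ e) ⊆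
      ((Finset.univ : Finset (Finset V)).filter fun W => W.card = r - 1 ∧ {u, v} ⊆ W).biUnion
        fun W => G.filter fun e => W ⊆ e := by
    intro e he
    obtain ⟨he, hPe⟩ := Finset.mem_filter.mp he
    obtain ⟨W, hPW, hWe, hW⟩ := Finset.exists_subsuperset_card_eq hPe
      (n := r - 1) (by omega) (by rw [hG e he]; omega)
    simp only [Finset.mem_biUnion, Finset.mem_filter, Finset.mem_univ, true_and]
    exact ⟨W, ⟨hW, hPW⟩, he, hWe⟩
  refine (Finset.card_le_card hsub).trans ?_
  refine (Finset.card_biUnion_le_card_mul _ _ Δ ?_).trans ?_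
  · intro W hW
    have hW := (Finset.mem_filter.mp hW).2.1
    exact (degSet_le_card_linkN (by omega) hG hW).trans (hΔ W hW)
  · have h := card_supersets_le ({u, v} : Finset V) (r - 1)
    rw [hP, show r - 1 - 2 = r - 3 by omega] at h
    exact Nat.mul_le_mul_right _ h

theorem card_CN_le [Fintype V] {r s t Δ : ℕ} (hr : 3 ≤ r) (hs : 1 ≤ s)
    {G : Finset (Finset V)} (hG : ∀ e ∈ G, e.card = r) (hfree : KstFree r s t G)
    (hΔ : ∀ T : Finset V, T.card = r - 1 → (linkN G T).card ≤ Δ)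
    {S : Finset V} (hS : S.card = s) :
    (CN r G S).card ≤ t * (r - 1) * (Fintype.card V ^ (r - 3) * Δ) := by
  have hmem : ∀ T, T ∈ CN r G S ↔ T.card = r - 1 ∧ ∀ v ∈ S, v ∉ T ∧ insert v T ∈ G := by
    simp [CN]
  rcases exists_disjoint_or_cover (CN r G S) (r - 1) (fun T hT => ((hmem T).mp hT).1) t with
    ⟨X, hX, hd⟩ | ⟨C, hC, hcov⟩
  · refine absurd ⟨X, S, fun i => ((hmem _).mp (hX i)).1, hS, hd, fun i => ?_, fun i y hy => ?_⟩
      hfree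
    · exact Finset.disjoint_right.mpr fun v hv => (((hmem _).mp (hX i)).2 v hv).1
    · exact (((hmem _).mp (hX i)).2 y hy).2
  · obtain ⟨v, hv⟩ : S.Nonempty := Finset.card_pos.mp (by omega)
    have hsub : CN r G S ⊆ C.biUnion fun u => (CN r G S).filter fun T => u ∈ T := by
      intro T hT
      obtain ⟨u, hu, huT⟩ := hcov T hT
      exact Finset.mem_biUnion.mpr ⟨u, hu, Finset.mem_filter.mpr ⟨hT, huT⟩⟩
    refine (Finset.card_le_card hsub).trans ?_
    refine (Finset.card_biUnion_le_card_mul _ _ (Fintype.card V ^ (r - 3) * Δ) ?_).trans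
      (Nat.mul_le_mul_right _ hC)
    intro u _
    by_cases huv : u = v
    · have : ((CN r G S).filter fun T => u ∈ T) = ∅ := by
        refine Finset.filter_eq_empty_iff.mpr fun T hT => ?_
        exact huv ▸ (((hmem T).mp hT).2 v hv).1
      rw [this, Finset.card_empty]
      exact Nat.zero_le _
    · refine le_trans ?_ (degSet_pair_le hr hG hΔ huv)
      refine Finset.card_le_card_of_injOn (fun T => insert v T) ?_ ?_
      · intro T hT
        obtain ⟨hT, huT⟩ := Finset.mem_filter.mp (Finset.mem_coe.mp hT)
        refine Finset.mem_coe.mpr (Finset.mem_filter.mpr ⟨(((hmem T).mp hT).2 v hv).2, ?_⟩)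
        intro x hx
        rcases Finset.mem_insert.mp hx with rfl | hx
        · exact Finset.mem_insert_of_mem huT
        · rw [Finset.mem_singleton.mp hx]
          exact Finset.mem_insert_self _ _
      · intro T hT T' hT' h
        have hT := (((hmem T).mp (Finset.mem_filter.mp (Finset.mem_coe.mp hT)).1).2 v hv).1
        have hT' := (((hmem T').mp (Finset.mem_filter.mp (Finset.mem_coe.mp hT')).1).2 v hv).1
        rw [← Finset.erase_insert hT, ← Finset.erase_insert hT']
        exact congrArg (fun W => W.erase v) h

/-- The `(r-1)`-sets whose neighborhood in `G` has at least `D` vertices. -/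
def heavySets (r D : ℕ) [Fintype V] (G : Finset (Finset V)) : Finset (Finset V) :=
  Finset.univ.filter fun T : Finset V => T.card = r - 1 ∧ D ≤ (linkN G T).card

theorem mem_heavySets {r D : ℕ} [Fintype V] {G : Finset (Finset V)} {T : Finset V} :
    T ∈ heavySets r D G ↔ T.card = r - 1 ∧ D ≤ (linkN G T).card := by
  simp [heavySets]

theorem card_heavySets_le [Fintype V] (r D : ℕ) (G : Finset (Finset V)) :
    (heavySets r D G).card ≤ Fintype.card V ^ (r - 1) := by
  have := card_supersets_le (∅ : Finset V) (r - 1)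
  rw [Finset.card_empty] at this
  refine le_trans (Finset.card_le_card fun T hT => ?_) this
  simpa using (mem_heavySets.mp hT).1

theorem card_heavySets_mul_choose_le [Fintype V] {r s t Δ D : ℕ} (hr : 3 ≤ r) (hs : 1 ≤ s)
    {G : Finset (Finset V)} (hG : ∀ e ∈ G, e.card = r) (hfree : KstFree r s t G)
    (hΔ : ∀ T : Finset V, T.card = r - 1 → (linkN G T).card ≤ Δ) :
    (heavySets r D G).card * D.choose s ≤
      Fintype.card V ^ s * (t * (r - 1) * (Fintype.card V ^ (r - 3) * Δ)) := by
  have h := Finset.card_mul_le_card_mul (s := heavySets r D G)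
    (t := (Finset.univ : Finset V).powersetCard s) (fun T S => S ⊆ linkN G T)
    (m := D.choose s) (n := t * (r - 1) * (Fintype.card V ^ (r - 3) * Δ)) ?_ ?_
  · refine h.trans (Nat.mul_le_mul_right _ ?_)
    rw [Finset.card_powersetCard, Finset.card_univ]
    exact Nat.choose_le_pow _ _
  · intro T hT
    refine (Nat.choose_le_choose s (mem_heavySets.mp hT).2).trans ?_
    rw [← Finset.card_powersetCard]
    refine Finset.card_le_card fun S hS => ?_
    rw [Finset.mem_powersetCard] at hS
    simp only [Finset.bipartiteAbove, Finset.mem_filter, Finset.mem_powersetCard]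
    exact ⟨⟨Finset.subset_univ _, hS.2⟩, hS.1⟩
  · intro S hS
    refine le_trans (Finset.card_le_card fun T hT => ?_)
      (card_CN_le hr hs hG hfree hΔ (Finset.mem_powersetCard.mp hS).2)
    obtain ⟨hT, hST⟩ := Finset.mem_filter.mp hT
    simp only [CN, Finset.mem_filter, Finset.mem_univ, true_and]
    refine ⟨(mem_heavySets.mp hT).1, fun v hv => ?_⟩
    simpa [linkN] using hST hv

theorem pow_le_two_pow_mul_factorial_mul_choose {D s : ℕ} (h : 2 * s ≤ D) :
    D ^ s ≤ 2 ^ s * (s.factorial * D.choose s) := by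
  rw [← Nat.descFactorial_eq_factorial_mul_choose]
  calc D ^ s ≤ (2 * (D + 1 - s)) ^ s := Nat.pow_le_pow_left (by omega) s
    _ = 2 ^ s * (D + 1 - s) ^ s := mul_pow _ _ _
    _ ≤ _ := Nat.mul_le_mul_left _ (Nat.pow_sub_le_descFactorial D s)

/-- A constant, depending only on the forbidden configuration, for the dyadic counting bound. -/
def kstConst (r s t : ℕ) : ℕ :=
  2 ^ s * 2 ^ s * s.factorial * (t * (r - 1)) + 4 * s

theorem heavy_mul_pow_le [Fintype V] {r s t D : ℕ} (hr : 3 ≤ r) (hs : 2 ≤ s)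
    {G : Finset (Finset V)} (hG : ∀ e ∈ G, e.card = r) (hfree : KstFree r s t G)
    (hD : 2 * s ≤ D)
    (hΔ : ∀ T : Finset V, T.card = r - 1 → (linkN G T).card ≤ 2 * D) :
    ((heavySets r D G).card * (2 * D)) ^ (s - 1) ≤
      kstConst r s t * Fintype.card V ^ (r * (s - 1) - 1) := by
  obtain ⟨a, rfl⟩ : ∃ a, s = a + 2 := ⟨s - 2, by omega⟩
  obtain ⟨b, rfl⟩ : ∃ b, r = b + 3 := ⟨r - 3, by omega⟩
  set N := (heavySets (b + 3) D G).card with hN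
  set n := Fintype.card V
  have hNle : N ≤ n ^ (b + 2) := card_heavySets_le (b + 3) D G
  have h1 := card_heavySets_mul_choose_le (D := D) hr (by omega) hG hfree hΔ
  rw [← hN] at h1
  have h2 := pow_le_two_pow_mul_factorial_mul_choose hD
  simp only [Nat.add_sub_cancel, show b + 3 - 1 = b + 2 by omega,
    show a + 2 - 1 = a + 1 by omega] at h1 ⊢
  have h3 : N * D ^ (a + 1) ≤
      2 ^ (a + 2) * (a + 2).factorial * (t * (b + 2)) * 2 * n ^ (a + b + 2) := by
    refine Nat.le_of_mul_le_mul_right ?_ (show 0 < D by omega)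
    calc N * D ^ (a + 1) * D = N * D ^ (a + 2) := by ring
      _ ≤ N * (2 ^ (a + 2) * ((a + 2).factorial * D.choose (a + 2))) := Nat.mul_le_mul_left _ h2
      _ = 2 ^ (a + 2) * (a + 2).factorial * (N * D.choose (a + 2)) := by ring
      _ ≤ 2 ^ (a + 2) * (a + 2).factorial *
          (n ^ (a + 2) * (t * (b + 2) * (n ^ b * (2 * D)))) := Nat.mul_le_mul_left _ h1
      _ = _ := by ring
  have hexp : (b + 3) * (a + 1) - 1 = (b + 2) * a + (a + b + 2) := by
    have : (b + 3) * (a + 1) = (b + 2) * a + (a + b + 2) + 1 := by ring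
    omega
  rw [hexp]
  calc (N * (2 * D)) ^ (a + 1) = 2 ^ (a + 1) * (N ^ a * (N * D ^ (a + 1))) := by ring
    _ ≤ 2 ^ (a + 1) * ((n ^ (b + 2)) ^ a *
        (2 ^ (a + 2) * (a + 2).factorial * (t * (b + 2)) * 2 * n ^ (a + b + 2))) := by gcongr
    _ = (2 ^ (a + 2) * 2 ^ (a + 2) * (a + 2).factorial * (t * (b + 2))) *
        n ^ ((b + 2) * a + (a + b + 2)) := by ring
    _ ≤ _ := Nat.mul_le_mul_right _ (by simp [kstConst])

/-- The edges of `G` containing one of the sets in `heavySets r D G`. -/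
def heavyEdges (r D : ℕ) [Fintype V] (G : Finset (Finset V)) : Finset (Finset V) :=
  G.filter fun e => ∃ T ∈ heavySets r D G, T ⊆ e

theorem card_heavy_edges_le [Fintype V] {r D Δ : ℕ} (hr : 1 ≤ r) {G : Finset (Finset V)}
    (hG : ∀ e ∈ G, e.card = r)
    (hΔ : ∀ T : Finset V, T.card = r - 1 → (linkN G T).card ≤ Δ) :
    (heavyEdges r D G).card ≤ (heavySets r D G).card * Δ := by
  have hsub : heavyEdges r D G ⊆
      (heavySets r D G).biUnion fun T => G.filter fun e => T ⊆ e := by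
    intro e he
    obtain ⟨he, T, hT, hTe⟩ := Finset.mem_filter.mp he
    exact Finset.mem_biUnion.mpr ⟨T, hT, Finset.mem_filter.mpr ⟨he, hTe⟩⟩
  refine (Finset.card_le_card hsub).trans (Finset.card_biUnion_le_card_mul _ _ Δ fun T hT => ?_)
  have hT := (mem_heavySets.mp hT).1
  exact (degSet_le_card_linkN hr hG hT).trans (hΔ T hT)

theorem le_rpow_of_pow_le {x A n r s : ℕ} (hr : 1 ≤ r) (hs : 2 ≤ s) (hA : 1 ≤ A) (hn : 1 ≤ n)
    (h : x ^ (s - 1) ≤ A * n ^ (r * (s - 1) - 1)) :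
    (x : ℝ) ≤ A * (n : ℝ) ^ ((r : ℝ) - 1 / ((s : ℝ) - 1)) := by
  obtain ⟨a, rfl⟩ : ∃ a, s = a + 2 := ⟨s - 2, by omega⟩
  have hn0 : (0 : ℝ) < n := by exact_mod_cast hn
  have hA1 : (1 : ℝ) ≤ A := by exact_mod_cast hA
  rw [show a + 2 - 1 = a + 1 by omega] at h
  refine le_of_pow_le_pow_left₀ (n := a + 1) (by omega) (by positivity) ?_
  have hpos : 1 ≤ r * (a + 1) := Nat.mul_pos hr (Nat.succ_pos a)
  have hpow : ((n : ℝ) ^ ((r : ℝ) - 1 / (((a + 2 : ℕ) : ℝ) - 1))) ^ (a + 1) =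
      (n : ℝ) ^ (r * (a + 1) - 1) := by
    rw [← Real.rpow_natCast, ← Real.rpow_mul hn0.le, ← Real.rpow_natCast]
    congr 1
    push_cast [Nat.cast_sub hpos]
    have : (a : ℝ) + 2 - 1 ≠ 0 := by
      have : (0 : ℝ) ≤ a := a.cast_nonneg
      linarith
    field_simp
    ring
  rw [mul_pow, hpow]
  calc (x : ℝ) ^ (a + 1) ≤ A * (n : ℝ) ^ (r * (a + 1) - 1) := by exact_mod_cast h
    _ ≤ _ := by
      gcongr
      exact le_self_pow₀ hA1 (by omega)

theorem card_heavy_edges_le_rpow [Fintype V] {r s t D : ℕ} (hr : 3 ≤ r) (hs : 2 ≤ s)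
    {G : Finset (Finset V)} (hG : ∀ e ∈ G, e.card = r) (hfree : KstFree r s t G)
    (hV : 1 ≤ Fintype.card V)
    (hΔ : ∀ T : Finset V, T.card = r - 1 → (linkN G T).card ≤ 2 * D) :
    ((heavyEdges r D G).card : ℝ) ≤
      kstConst r s t * (Fintype.card V : ℝ) ^ ((r : ℝ) - 1 / ((s : ℝ) - 1)) := by
  have hx := card_heavy_edges_le (D := D) (by omega) hG hΔ
  rcases le_or_gt (2 * s) D with hD | hD
  · refine le_trans (Nat.cast_le.mpr hx) ?_
    refine le_rpow_of_pow_le (by omega) hs ?_ hV (heavy_mul_pow_le hr hs hG hfree hD hΔ)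
    unfold kstConst
    omega
  · have hnat : (heavyEdges r D G).card ≤
        kstConst r s t * Fintype.card V ^ (r - 1) := by
      rw [mul_comm]
      refine hx.trans (Nat.mul_le_mul (card_heavySets_le r D G) ?_)
      unfold kstConst
      omega
    refine le_trans (Nat.cast_le.mpr hnat) ?_
    push_cast
    refine mul_le_mul_of_nonneg_left ?_ (Nat.cast_nonneg _)
    rw [← Real.rpow_natCast]
    refine Real.rpow_le_rpow_of_exponent_le (by exact_mod_cast hV) ?_
    rw [Nat.cast_sub (by omega), Nat.cast_one]
    have hs' : (2 : ℝ) ≤ s := by exact_mod_cast hs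
    have : 1 / ((s : ℝ) - 1) ≤ 1 := by
      rw [div_le_one (by linarith)]
      linarith
    linarith

theorem KstFree.mono {r s t : ℕ} {G H : Finset (Finset V)} (hG : KstFree r s t G) (h : H ⊆ G) :
    KstFree r s t H := fun ⟨X, Y, h1, h2, h3, h4, h5⟩ =>
  hG ⟨X, Y, h1, h2, h3, h4, fun i y hy => h (h5 i y hy)⟩

theorem linkN_mono [Fintype V] {G H : Finset (Finset V)} (h : H ⊆ G) (T : Finset V) :
    linkN H T ⊆ linkN G T := by
  intro v hv
  simp only [linkN, Finset.mem_filter, Finset.mem_univ, true_and] at hv ⊢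
  exact ⟨hv.1, h hv.2⟩

theorem card_le_of_linkN_lt_two_pow [Fintype V] {r s t : ℕ} (hr : 3 ≤ r) (hs : 2 ≤ s)
    (hV : 1 ≤ Fintype.card V) (k : ℕ) (G : Finset (Finset V))
    (hG : ∀ e ∈ G, e.card = r) (hfree : KstFree r s t G)
    (hΔ : ∀ T : Finset V, T.card = r - 1 → (linkN G T).card < 2 ^ k) :
    (G.card : ℝ) ≤
      k * (kstConst r s t * (Fintype.card V : ℝ) ^ ((r : ℝ) - 1 / ((s : ℝ) - 1))) := by
  induction k generalizing G with
  | zero =>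
    have : G = ∅ := by
      refine Finset.eq_empty_of_forall_notMem fun e he => ?_
      obtain ⟨v, hv⟩ : e.Nonempty := Finset.card_pos.mp (by rw [hG e he]; omega)
      have h := hΔ (e.erase v) (by rw [Finset.card_erase_of_mem hv, hG e he])
      rw [pow_zero, Nat.lt_one_iff, Finset.card_eq_zero] at h
      have hmem : v ∈ linkN G (e.erase v) := by
        simp only [linkN, Finset.mem_filter, Finset.mem_univ, true_and]
        exact ⟨Finset.notMem_erase v e, by rwa [Finset.insert_erase hv]⟩
      rw [h] at hmem
      exact Finset.notMem_empty v hmem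
    simp [this]
  | succ k ih =>
    have hheavy := card_heavy_edges_le_rpow (D := 2 ^ k) hr hs hG hfree hV
      fun T hT => (hΔ T hT).le.trans (by rw [pow_succ, mul_comm])
    set Q := heavyEdges r (2 ^ k) G
    have hQ : Q ⊆ G := Finset.filter_subset _ G
    have hsub : G \ Q ⊆ G := Finset.sdiff_subset
    have hlight := ih (G \ Q) (fun e he => hG e (hsub he)) (hfree.mono hsub) fun T hT => by
      by_contra! hcon
      obtain ⟨v, hv⟩ := Finset.card_pos.mp ((Nat.two_pow_pos k).trans_le hcon)
      simp only [linkN, Finset.mem_filter, Finset.mem_univ, true_and] at hv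
      obtain ⟨hvG, hvQ⟩ := Finset.mem_sdiff.mp hv.2
      have hheavyT : T ∈ heavySets r (2 ^ k) G :=
        mem_heavySets.mpr ⟨hT, hcon.trans (Finset.card_le_card (linkN_mono hsub T))⟩
      exact hvQ (Finset.mem_filter.mpr ⟨hvG, T, hheavyT, Finset.subset_insert v T⟩)
    rw [← Finset.card_sdiff_add_card_eq_card hQ]
    push_cast
    linarith

theorem stmt_18 (r s t : ℕ) (hr : 3 ≤ r) (hs : 2 ≤ s) (ht : 2 ≤ t) :
    ∃ n₀ : ℕ, ∀ n ≥ n₀, ∀ G : Finset (Finset (Fin n)),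
      (∀ e ∈ G, e.card = r) → KstFree r s t G →
      (G.card : ℝ) ≤ (n : ℝ) ^ ((r : ℝ) - 1 / ((s : ℝ) - 1)) *
        (Real.logb 2 (n : ℝ)) ^ (2 * r) := by
  refine ⟨2 ^ (kstConst r s t + 1), fun n hn G hG hfree => ?_⟩
  have hn1 : 1 ≤ n := Nat.one_le_two_pow.trans hn
  have hn0 : (0 : ℝ) < n := by exact_mod_cast hn1
  have h := card_le_of_linkN_lt_two_pow hr hs (by simpa using hn1) (Nat.log 2 n + 1) G hG hfree
    fun T _ => ((Finset.card_le_univ _).trans_eq (Fintype.card_fin n)).trans_lt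
      (Nat.lt_pow_succ_log_self one_lt_two n)
  rw [Fintype.card_fin] at h
  set L := Real.logb 2 (n : ℝ) with hL
  set A := kstConst r s t
  have hlog : ((Nat.log 2 n : ℕ) : ℝ) ≤ L := Real.natLog_le_logb n 2
  have hAL : (A : ℝ) + 1 ≤ L := by
    rw [hL, Real.le_logb_iff_rpow_le one_lt_two hn0]
    exact_mod_cast hn
  have hA0 : (0 : ℝ) ≤ A := A.cast_nonneg
  have hpow : L ^ 2 ≤ L ^ (2 * r) := pow_le_pow_right₀ (by linarith) (by omega)
  have hcoef : (((Nat.log 2 n + 1 : ℕ) : ℝ)) * A ≤ L ^ (2 * r) := by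
    push_cast
    nlinarith
  refine h.trans ?_
  rw [← mul_assoc, mul_comm]
  exact mul_le_mul_of_nonneg_left hcoef (Real.rpow_nonneg hn0.le _)

end
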